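/- Let M be a real n×n P-matrix, q ∈ ℝⁿ, and let x* be the unique solution of LCP(M, q). Let ΔM be an n×n matrix and Δq ∈ ℝⁿ with ‖ΔM‖ ≤ ε_M ‖M‖ and ‖Δq‖ ≤ ε_q ‖q‖ for constants ε_M, ε_q ≥ 0, and suppose η := ε_M β(M) ‖M‖ < 1, where β(M) = max over diagonal D = diag(d), d ∈ [0,1]ⁿ, of ‖(I − D + DM)⁻¹ D‖. Then the perturbed problem LCP(M + ΔM, q + Δq) has a unique solution x*_Δ, and with ε := max{ε_M ‖M‖ ‖x*‖, ε_q ‖q‖} one has ‖x* − x*_Δ‖ ≤ (2ε / (1 − η)) · β(M). -/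

import Mathlib

open scoped RealInnerProductSpace

/-- `A` is a P-matrix: every principal minor is positive. -/
def IsPMatrix {n : ℕ} (A : Matrix (Fin n) (Fin n) ℝ) : Prop :=
  ∀ J : Finset (Fin n), J.Nonempty →
    0 < (A.submatrix (fun j : J => (j : Fin n)) (fun j : J => (j : Fin n))).det

/-- `β(A) = max_{d ∈ [0,1]ⁿ} ‖(I − D + D A)⁻¹ D‖`, where `D = diag(d)` and `‖·‖` is the
operator norm induced by the Euclidean norm. -/
noncomputable def betaP {n : ℕ} (A : Matrix (Fin n) (Fin n) ℝ) : ℝ :=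
  sSup ((fun d : Fin n → ℝ =>
      ‖Matrix.toEuclideanCLM (𝕜 := ℝ)
        ((1 - Matrix.diagonal d + Matrix.diagonal d * A)⁻¹ * Matrix.diagonal d)‖) ''
    {d : Fin n → ℝ | ∀ i, d i ∈ Set.Icc (0 : ℝ) 1})

/-- `x` solves the linear complementarity problem `LCP(M, q)`. -/
def IsLCPSol {n : ℕ} (M : Matrix (Fin n) (Fin n) ℝ) (q x : EuclideanSpace ℝ (Fin n)) : Prop :=
  (∀ i, 0 ≤ x i) ∧ (∀ i, 0 ≤ (Matrix.toEuclideanCLM (𝕜 := ℝ) M x + q) i) ∧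
    ⟪x, Matrix.toEuclideanCLM (𝕜 := ℝ) M x + q⟫ = 0

open Matrix in
/-- Expansion of a diagonal interpolation between the identity and `A` into principal minors. -/
theorem det_one_sub_diagonal_add_diagonal_mul {n : ℕ} (A : Matrix (Fin n) (Fin n) ℝ)
    (d : Fin n → ℝ) :
    (1 - diagonal d + diagonal d * A).det =
      ∑ s : Finset (Fin n), (∏ i, if i ∈ s then d i else 1 - d i) *
        (A.submatrix (fun j : s => (j : Fin n)) (fun j : s => (j : Fin n))).det := by
  have hsplit : (1 - diagonal d + diagonal d * A : Matrix (Fin n) (Fin n) ℝ) =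
      Matrix.of ((fun i => d i • A.row i) +
        fun i => (1 - d i) • (1 : Matrix (Fin n) (Fin n) ℝ).row i) := by
    ext i j
    by_cases hij : i = j
    · subst hij
      simp [diagonal_mul, Matrix.row]
      ring
    · simp [diagonal_mul, Matrix.row, hij]
  rw [hsplit]
  refine (detRowAlternating.map_add_univ _ _).trans (Finset.sum_congr rfl fun s _ => ?_)
  rw [← det_piecewise_one_eq_submatrix_det]
  refine (congrArg detRowAlternating ?_).trans (detRowAlternating.map_smul_univ _ _)
  ext i j
  by_cases hi : i ∈ s <;> simp [hi]

/-- A P-matrix interpolated diagonally with the identity has positive determinant. -/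
theorem IsPMatrix.det_interpolation_pos {n : ℕ} {A : Matrix (Fin n) (Fin n) ℝ} (hA : IsPMatrix A)
    {d : Fin n → ℝ} (hd : ∀ i, d i ∈ Set.Icc (0 : ℝ) 1) :
    0 < (1 - Matrix.diagonal d + Matrix.diagonal d * A).det := by
  have hminor (s : Finset (Fin n)) :
      0 < (A.submatrix (fun j : s => (j : Fin n)) (fun j : s => (j : Fin n))).det := by
    rcases s.eq_empty_or_nonempty with rfl | hs
    · simp
    · exact hA s hs
  rw [det_one_sub_diagonal_add_diagonal_mul]
  refine Finset.sum_pos' (fun s _ => mul_nonneg (Finset.prod_nonneg fun i _ => ?_) (hminor s).le)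
    ⟨Finset.univ.filter fun i => 0 < d i, Finset.mem_univ _,
      mul_pos (Finset.prod_pos fun i _ => ?_) (hminor _)⟩
  · split_ifs
    exacts [(hd i).1, sub_nonneg.2 (hd i).2]
  · by_cases hi : 0 < d i
    · simp [hi]
    · have : d i = 0 := le_antisymm (not_lt.1 hi) (hd i).1
      simp [this]

/-- The matrices `(I - D' + D' A)⁻¹ D`, with `D` and `D'` diagonal with entries in `[0, 1]`,
are uniformly bounded if `A` is a P-matrix. -/
theorem IsPMatrix.exists_norm_inv_mul_le {n : ℕ} {A : Matrix (Fin n) (Fin n) ℝ}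
    (hA : IsPMatrix A) :
    ∃ C : ℝ, ∀ d' d : Fin n → ℝ, (∀ i, d' i ∈ Set.Icc (0 : ℝ) 1) →
      (∀ i, d i ∈ Set.Icc (0 : ℝ) 1) →
      ‖Matrix.toEuclideanCLM (𝕜 := ℝ)
        ((1 - Matrix.diagonal d' + Matrix.diagonal d' * A)⁻¹ * Matrix.diagonal d)‖ ≤ C := by
  let K : Set (Fin n → ℝ) := Set.univ.pi fun _ => Set.Icc (0 : ℝ) 1
  have hK : IsCompact K := isCompact_univ_pi fun _ => isCompact_Icc
  let B : (Fin n → ℝ) × (Fin n → ℝ) → Matrix (Fin n) (Fin n) ℝ := fun p =>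
    1 - Matrix.diagonal p.1 + Matrix.diagonal p.1 * A
  have hB : Continuous B := by
    dsimp only [B]
    fun_prop
  have hinv : ContinuousOn (fun p => (B p)⁻¹) (K ×ˢ K) := by
    simp_rw [Matrix.inv_def, Ring.inverse_eq_inv']
    refine (hB.matrix_det.continuousOn.inv₀ fun p hp => ?_).smul hB.matrix_adjugate.continuousOn
    exact (hA.det_interpolation_pos fun i => hp.1 i trivial).ne'
  have hCLM : Continuous (Matrix.toEuclideanCLM (n := Fin n) (𝕜 := ℝ)) :=
    (Matrix.toEuclideanCLM (n := Fin n)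
      (𝕜 := ℝ)).toAlgEquiv.toLinearMap.continuous_of_finiteDimensional
  have hcont : ContinuousOn (fun p : (Fin n → ℝ) × (Fin n → ℝ) =>
      ‖Matrix.toEuclideanCLM (𝕜 := ℝ) ((B p)⁻¹ * Matrix.diagonal p.2)‖) (K ×ˢ K) :=
    (hCLM.comp_continuousOn
      (hinv.mul (continuous_snd.matrix_diagonal).continuousOn)).norm
  obtain ⟨C, hC⟩ := (hK.prod hK).bddAbove_image hcont
  exact ⟨C, fun d' d hd' hd =>
    hC ⟨(d', d), ⟨fun i _ => hd' i, fun i _ => hd i⟩, rfl⟩⟩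

/-- Complementarity holds in each coordinate. -/
theorem IsLCPSol.mul_eq_zero {n : ℕ} {A : Matrix (Fin n) (Fin n) ℝ}
    {q x : EuclideanSpace ℝ (Fin n)} (h : IsLCPSol A q x) (i : Fin n) :
    x i * (Matrix.toEuclideanCLM (𝕜 := ℝ) A x + q) i = 0 := by
  obtain ⟨hx, hu, hxu⟩ := h
  rw [PiLp.inner_apply, Finset.sum_eq_zero_iff_of_nonneg
    fun i _ => by simpa using mul_nonneg (hu i) (hx i)] at hxu
  simpa [mul_comm] using hxu i (Finset.mem_univ i)

theorem exists_mem_Icc_interpolation_eq_zero {a b : ℝ} (hab : a * b ≤ 0) :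
    ∃ t ∈ Set.Icc (0 : ℝ) 1, (1 - t) * a + t * b = 0 := by
  by_cases h : a = b
  · subst h
    have : a = 0 := by nlinarith
    exact ⟨0, by simp, by simp [this]⟩
  · have hne : a - b ≠ 0 := sub_ne_zero.2 h
    have hpos : 0 < (a - b) ^ 2 := by positivity
    refine ⟨a / (a - b), ?_, by field_simp; ring⟩
    have hrw : a / (a - b) = a * (a - b) / (a - b) ^ 2 := by field_simp
    rw [hrw, Set.mem_Icc, div_le_one hpos]
    exact ⟨div_nonneg (by nlinarith [sq_nonneg a]) hpos.le, by nlinarith [sq_nonneg b]⟩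

/-- The difference of solutions of two complementarity problems with the same matrix solves a
linear system with a diagonally interpolated matrix. -/
theorem IsLCPSol.exists_interpolation {n : ℕ} {A : Matrix (Fin n) (Fin n) ℝ}
    {q q' x y : EuclideanSpace ℝ (Fin n)} (hx : IsLCPSol A q x) (hy : IsLCPSol A q' y) :
    ∃ d : Fin n → ℝ, (∀ i, d i ∈ Set.Icc (0 : ℝ) 1) ∧
      Matrix.toEuclideanCLM (𝕜 := ℝ) (1 - Matrix.diagonal d + Matrix.diagonal d * A) (x - y) =
        Matrix.toEuclideanCLM (𝕜 := ℝ) (Matrix.diagonal d) (q' - q) := by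
  have hcoord (i : Fin n) : ∃ t ∈ Set.Icc (0 : ℝ) 1, (1 - t) * (x i - y i) +
      t * ((Matrix.toEuclideanCLM (𝕜 := ℝ) A x + q) i -
        (Matrix.toEuclideanCLM (𝕜 := ℝ) A y + q') i) = 0 := by
    apply exists_mem_Icc_interpolation_eq_zero
    nlinarith [hx.mul_eq_zero i, hy.mul_eq_zero i, mul_nonneg (hx.1 i) (hy.2.1 i),
      mul_nonneg (hy.1 i) (hx.2.1 i)]
  choose d hd hzero using hcoord
  refine ⟨d, hd, ?_⟩
  ext i
  have h := hzero i
  simp only [PiLp.add_apply, Matrix.ofLp_toEuclideanCLM] at h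
  simp only [Matrix.ofLp_toEuclideanCLM, Matrix.add_mulVec, Matrix.sub_mulVec, Matrix.one_mulVec,
    ← Matrix.mulVec_mulVec, Matrix.mulVec_diagonal, WithLp.ofLp_sub, Pi.add_apply, Pi.sub_apply,
    Matrix.mulVec_sub]
  linarith

/-- Solutions of the problems `LCP(A, ·)` depend on the vector in a `C`-Lipschitz way. -/
def LCPLipschitz {n : ℕ} (A : Matrix (Fin n) (Fin n) ℝ) (C : ℝ) : Prop :=
  ∀ q q' x y : EuclideanSpace ℝ (Fin n), IsLCPSol A q x → IsLCPSol A q' y →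
    ‖x - y‖ ≤ C * ‖q - q'‖

theorem lcpLipschitz_of_norm_inv_mul_le {n : ℕ} {A : Matrix (Fin n) (Fin n) ℝ} {C : ℝ}
    (hA : ∀ d : Fin n → ℝ, (∀ i, d i ∈ Set.Icc (0 : ℝ) 1) →
      IsUnit (1 - Matrix.diagonal d + Matrix.diagonal d * A).det ∧
      ‖Matrix.toEuclideanCLM (𝕜 := ℝ)
        ((1 - Matrix.diagonal d + Matrix.diagonal d * A)⁻¹ * Matrix.diagonal d)‖ ≤ C) :
    LCPLipschitz A C := by
  intro q q' x y hx hy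
  obtain ⟨d, hd, h⟩ := hx.exists_interpolation hy
  obtain ⟨hunit, hC⟩ := hA d hd
  have hxy : x - y = Matrix.toEuclideanCLM (𝕜 := ℝ)
      ((1 - Matrix.diagonal d + Matrix.diagonal d * A)⁻¹ * Matrix.diagonal d) (q' - q) := by
    rw [map_mul, mul_apply_eq_comp, ← h, ← mul_apply_eq_comp, ← map_mul,
      Matrix.nonsing_inv_mul _ hunit, map_one, one_apply_eq_self]
  rw [hxy, norm_sub_rev q q']
  exact ContinuousLinearMap.le_of_opNorm_le _ hC _

theorem IsPMatrix.lcpLipschitz_betaP {n : ℕ} {A : Matrix (Fin n) (Fin n) ℝ} (hA : IsPMatrix A) :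
    LCPLipschitz A (betaP A) := by
  refine lcpLipschitz_of_norm_inv_mul_le fun d hd => ⟨(hA.det_interpolation_pos hd).ne'.isUnit, ?_⟩
  obtain ⟨C, hC⟩ := hA.exists_norm_inv_mul_le
  refine le_csSup ⟨C, ?_⟩ ⟨d, hd, rfl⟩
  rintro _ ⟨d, hd, rfl⟩
  exact hC d d hd hd

/-- The Lipschitz constant is uniform on the segment from the identity to a P-matrix. -/
theorem IsPMatrix.exists_lcpLipschitz_segment {n : ℕ} {A : Matrix (Fin n) (Fin n) ℝ}
    (hA : IsPMatrix A) :
    ∃ C : ℝ, ∀ t ∈ Set.Icc (0 : ℝ) 1, LCPLipschitz (1 + t • (A - 1)) C := by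
  obtain ⟨C, hC⟩ := hA.exists_norm_inv_mul_le
  refine ⟨C, fun t ht => lcpLipschitz_of_norm_inv_mul_le fun d hd => ?_⟩
  have htd (i : Fin n) : (t • d) i ∈ Set.Icc (0 : ℝ) 1 :=
    ⟨mul_nonneg ht.1 (hd i).1, mul_le_one₀ ht.2 (hd i).1 (hd i).2⟩
  have hrw : 1 - Matrix.diagonal d + Matrix.diagonal d * (1 + t • (A - 1)) =
      1 - Matrix.diagonal (t • d) + Matrix.diagonal (t • d) * A := by
    rw [Matrix.diagonal_smul, mul_add, mul_one, Matrix.mul_smul, mul_sub, mul_one, smul_sub,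
      Matrix.smul_mul]
    abel
  rw [hrw]
  exact ⟨(hA.det_interpolation_pos htd).ne'.isUnit, hC _ _ htd hd⟩

theorem isLCPSol_add_iff {n : ℕ} {A B : Matrix (Fin n) (Fin n) ℝ}
    {q x : EuclideanSpace ℝ (Fin n)} :
    IsLCPSol (A + B) q x ↔ IsLCPSol A (Matrix.toEuclideanCLM (𝕜 := ℝ) B x + q) x := by
  simp only [IsLCPSol, map_add, add_apply, add_assoc]

/-- Solvability of `LCP(A, ·)` persists under small perturbations of `A`. -/
theorem LCPLipschitz.exists_isLCPSol_add {n : ℕ} {A B : Matrix (Fin n) (Fin n) ℝ} {C : ℝ}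
    (hLip : LCPLipschitz A C) (hA : ∀ q, ∃ x, IsLCPSol A q x)
    {η : ℝ} (hη : η < 1) (hB : C * ‖Matrix.toEuclideanCLM (𝕜 := ℝ) B‖ ≤ η)
    (hC : 0 ≤ C) (q : EuclideanSpace ℝ (Fin n)) : ∃ x, IsLCPSol (A + B) q x := by
  choose S hS using hA
  let T : EuclideanSpace ℝ (Fin n) → EuclideanSpace ℝ (Fin n) := fun y =>
    S (Matrix.toEuclideanCLM (𝕜 := ℝ) B y + q)
  have hη0 : 0 ≤ η := (mul_nonneg hC (norm_nonneg _)).trans hB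
  have hT : ContractingWith η.toNNReal T := by
    refine ⟨by simpa using hη, LipschitzWith.of_dist_le_mul fun y z => ?_⟩
    rw [Real.coe_toNNReal _ hη0, dist_eq_norm, dist_eq_norm]
    calc ‖T y - T z‖ ≤ C * ‖(Matrix.toEuclideanCLM (𝕜 := ℝ) B y + q) -
          (Matrix.toEuclideanCLM (𝕜 := ℝ) B z + q)‖ := hLip _ _ _ _ (hS _) (hS _)
      _ = C * ‖Matrix.toEuclideanCLM (𝕜 := ℝ) B (y - z)‖ := by
        rw [add_sub_add_right_eq_sub, map_sub]
      _ ≤ C * (‖Matrix.toEuclideanCLM (𝕜 := ℝ) B‖ * ‖y - z‖) := by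
        gcongr
        exact ContinuousLinearMap.le_opNorm _ _
      _ ≤ η * ‖y - z‖ := by
        rw [← mul_assoc]
        gcongr
  refine ⟨hT.fixedPoint, isLCPSol_add_iff.2 ?_⟩
  have hfix : T hT.fixedPoint = hT.fixedPoint := hT.fixedPoint_isFixedPt
  have hsol := hS (Matrix.toEuclideanCLM (𝕜 := ℝ) B hT.fixedPoint + q)
  change IsLCPSol A _ (T hT.fixedPoint) at hsol
  rwa [hfix] at hsol

theorem exists_isLCPSol_one {n : ℕ} (q : EuclideanSpace ℝ (Fin n)) :
    ∃ x, IsLCPSol (1 : Matrix (Fin n) (Fin n) ℝ) q x := by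
  refine ⟨WithLp.toLp 2 fun i => max (-q i) 0, fun i => le_max_right _ _, fun i => ?_, ?_⟩
  · have := le_max_left (-q i) 0
    simp only [map_one, one_apply_eq_self, PiLp.add_apply]
    linarith
  · rw [PiLp.inner_apply]
    refine Finset.sum_eq_zero fun i _ => ?_
    rcases le_total (-q i) 0 with h | h <;> simp [h]

/-- A linear complementarity problem with a P-matrix has a solution. -/
theorem IsPMatrix.exists_isLCPSol {n : ℕ} {A : Matrix (Fin n) (Fin n) ℝ} (hA : IsPMatrix A)
    (q : EuclideanSpace ℝ (Fin n)) : ∃ x, IsLCPSol A q x := by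
  obtain ⟨C₀, hC₀⟩ := hA.exists_lcpLipschitz_segment
  let C := max C₀ 0
  have hC (t : ℝ) (ht : t ∈ Set.Icc (0 : ℝ) 1) : LCPLipschitz (1 + t • (A - 1)) C :=
    fun q q' x y hx hy => (hC₀ t ht q q' x y hx hy).trans (by gcongr; exact le_max_left _ _)
  obtain ⟨N, hN⟩ := exists_nat_gt (C * ‖Matrix.toEuclideanCLM (n := Fin n) (𝕜 := ℝ) (A - 1)‖)
  have hN0 : (0 : ℝ) < N := (mul_nonneg (le_max_right _ _) (norm_nonneg _)).trans_lt hN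
  have hstep (k : ℕ) (hk : k ≤ N) :
      ∀ q, ∃ x, IsLCPSol (1 + ((k : ℝ) / N) • (A - 1)) q x := by
    induction k with
    | zero => simpa using exists_isLCPSol_one
    | succ k ih =>
      have hkN : ((k : ℝ) / N) ∈ Set.Icc (0 : ℝ) 1 :=
        ⟨by positivity, (div_le_one hN0).2 (by exact_mod_cast (Nat.le_succ k).trans hk)⟩
      have hrw : 1 + (((k + 1 : ℕ) : ℝ) / N) • (A - 1) =
          1 + ((k : ℝ) / N) • (A - 1) + (1 / (N : ℝ)) • (A - 1) := by
        rw [add_assoc, ← add_smul, ← add_div, Nat.cast_succ]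
      rw [hrw]
      refine (hC _ hkN).exists_isLCPSol_add (ih ((Nat.le_succ k).trans hk))
        ((div_lt_one hN0).2 hN) (le_of_eq ?_) (le_max_right _ _)
      rw [map_smul, norm_smul, Real.norm_of_nonneg (by positivity)]
      ring
  have hlast := hstep N le_rfl q
  rwa [div_self hN0.ne', one_smul, add_sub_cancel] at hlast

theorem betaP_nonneg {n : ℕ} (A : Matrix (Fin n) (Fin n) ℝ) : 0 ≤ betaP A :=
  Real.sSup_nonneg fun _ ⟨_, _, h⟩ => h ▸ norm_nonneg _


/-- Perturbation of the market equilibrium: if `M` is a P-matrix, `x*` solves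
`LCP(M, q)`, `‖ΔM‖ ≤ ε_M ‖M‖`, `‖Δq‖ ≤ ε_q ‖q‖` and `η := ε_M β(M) ‖M‖ < 1`, then the
perturbed problem `LCP(M + ΔM, q + Δq)` has a unique solution `x*_Δ`, and with
`ε := max {ε_M ‖M‖ ‖x*‖, ε_q ‖q‖}` one has `‖x* − x*_Δ‖ ≤ (2ε / (1 − η)) β(M)`. -/
theorem stmt_12 {n : ℕ} (M ΔM : Matrix (Fin n) (Fin n) ℝ)
    (q Δq xstar : EuclideanSpace ℝ (Fin n)) (εM εq : ℝ)
    (hεM : 0 ≤ εM) (hεq : 0 ≤ εq)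
    (hM : IsPMatrix M) (hxstar : IsLCPSol M q xstar)
    (hΔM : ‖Matrix.toEuclideanCLM (𝕜 := ℝ) ΔM‖ ≤ εM * ‖Matrix.toEuclideanCLM (𝕜 := ℝ) M‖)
    (hΔq : ‖Δq‖ ≤ εq * ‖q‖)
    (hη : εM * betaP M * ‖Matrix.toEuclideanCLM (𝕜 := ℝ) M‖ < 1) :
    (∃! xΔ : EuclideanSpace ℝ (Fin n), IsLCPSol (M + ΔM) (q + Δq) xΔ) ∧
    ∀ xΔ : EuclideanSpace ℝ (Fin n), IsLCPSol (M + ΔM) (q + Δq) xΔ →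
      ‖xstar - xΔ‖ ≤
        2 * max (εM * ‖Matrix.toEuclideanCLM (𝕜 := ℝ) M‖ * ‖xstar‖) (εq * ‖q‖) /
          (1 - εM * betaP M * ‖Matrix.toEuclideanCLM (𝕜 := ℝ) M‖) * betaP M := by
  set m := ‖Matrix.toEuclideanCLM (𝕜 := ℝ) M‖
  set β := betaP M
  have hβ : 0 ≤ β := betaP_nonneg M
  have hLip : LCPLipschitz M β := hM.lcpLipschitz_betaP
  have hβΔ : β * ‖Matrix.toEuclideanCLM (𝕜 := ℝ) ΔM‖ ≤ εM * β * m := by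
    calc β * ‖Matrix.toEuclideanCLM (𝕜 := ℝ) ΔM‖ ≤ β * (εM * m) := by gcongr
      _ = εM * β * m := by ring
  have hη_pos : 0 < 1 - εM * β * m := sub_pos.2 hη
  refine ⟨?_, fun xΔ hxΔ => ?_⟩
  · obtain ⟨x, hx⟩ := hLip.exists_isLCPSol_add hM.exists_isLCPSol hη hβΔ hβ (q + Δq)
    refine ⟨x, hx, fun y hy => ?_⟩
    have h := hLip _ _ _ _ (isLCPSol_add_iff.1 hy) (isLCPSol_add_iff.1 hx)
    rw [add_sub_add_right_eq_sub, ← map_sub] at h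
    have hle : ‖y - x‖ ≤ εM * β * m * ‖y - x‖ := by
      calc ‖y - x‖ ≤ β * (‖Matrix.toEuclideanCLM (𝕜 := ℝ) ΔM‖ * ‖y - x‖) :=
            h.trans (by gcongr; exact ContinuousLinearMap.le_opNorm _ _)
        _ ≤ εM * β * m * ‖y - x‖ := by
          rw [← mul_assoc]
          gcongr
    have hzero : ‖y - x‖ = 0 := by nlinarith [norm_nonneg (y - x)]
    exact sub_eq_zero.1 (norm_eq_zero.1 hzero)
  · have h := hLip _ _ _ _ hxstar (isLCPSol_add_iff.1 hxΔ)
    set ε := max (εM * m * ‖xstar‖) (εq * ‖q‖)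
    set L := Matrix.toEuclideanCLM (𝕜 := ℝ) ΔM
    have hsplit : q - (L xΔ + (q + Δq)) = L (xstar - xΔ) - L xstar - Δq := by
      rw [map_sub]
      abel
    have hres : ‖q - (L xΔ + (q + Δq))‖ ≤ εM * m * ‖xstar - xΔ‖ + ε + ε := by
      rw [hsplit]
      refine (norm_sub_le _ _).trans (add_le_add ((norm_sub_le _ _).trans (add_le_add ?_ ?_)) ?_)
      · exact L.le_of_opNorm_le hΔM _
      · exact (L.le_of_opNorm_le hΔM _).trans (le_max_left _ _)
      · exact hΔq.trans (le_max_right _ _)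
    have hfinal := h.trans (mul_le_mul_of_nonneg_left hres hβ)
    rw [div_mul_eq_mul_div, le_div_iff₀ hη_pos]
    linarith
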